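/- In the setting of the MA-BC guarantee, suppose |X \ X_common| = K and |X| ≥ 2K, and let C = max_{ℓ ∈ [L]} ‖ν^{π_ℓ}/ν^{π_data}‖_∞. Then there exists a universal constant c > 0 such that for any ε > 0, if the total sample size satisfies N ≥ c·C·|X| / ((1−γ)² ε) and every individual dataset size satisfies N_ℓ ≥ c·K / ((1−γ)² ε), then every policy π̂_ℓ output by MA-BC is an ε-PF policy. -/

import Mathlib

open scoped BigOperators
open Classical

/-- A Multi-Objective Markov Decision Process with finite state space `X`,
finite action space `A`, and `d`-dimensional rewards in `[0,1]^d`. -/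
structure MOMDP (X A : Type) [Fintype X] [Fintype A] (d : ℕ) where
  P : X → A → X → ℝ
  P_nonneg : ∀ x a x', 0 ≤ P x a x'
  P_sum_one : ∀ x a, ∑ x', P x a x' = 1
  disc : ℝ
  disc_nonneg : 0 ≤ disc
  disc_lt_one : disc < 1
  init : X → ℝ
  init_nonneg : ∀ x, 0 ≤ init x
  init_sum_one : ∑ x, init x = 1
  r : X → A → Fin d → ℝ
  r_nonneg : ∀ x a i, 0 ≤ r x a i
  r_le_one : ∀ x a i, r x a i ≤ 1

/-- A stationary (Markov) policy: a map from states to distributions over actions. -/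
def IsPolicy {X A : Type} [Fintype A] (π : X → A → ℝ) : Prop :=
  (∀ x a, 0 ≤ π x a) ∧ ∀ x, ∑ a, π x a = 1

/-- The stochastic policy induced by a deterministic policy `f : X → A`. -/
noncomputable def detPolicy {X A : Type} (f : X → A) : X → A → ℝ :=
  fun x a => if a = f x then 1 else 0

/-- The distribution of the state at time `t` under policy `π`. -/
noncomputable def stateDist {X A : Type} [Fintype X] [Fintype A] {d : ℕ}
    (M : MOMDP X A d) (π : X → A → ℝ) : ℕ → X → ℝ
  | 0 => M.init
  | t + 1 => fun x' => ∑ x, ∑ a, stateDist M π t x * π x a * M.P x a x'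

/-- The expected discounted vector return `J(π)`, componentwise. -/
noncomputable def Jret {X A : Type} [Fintype X] [Fintype A] {d : ℕ}
    (M : MOMDP X A d) (π : X → A → ℝ) (i : Fin d) : ℝ :=
  ∑' t : ℕ, M.disc ^ t * ∑ x, ∑ a, stateDist M π t x * π x a * M.r x a i

/-- Pareto front policy: no stationary policy weakly dominates it in all objectives and
strictly in one. -/
def IsPF {X A : Type} [Fintype X] [Fintype A] {d : ℕ}
    (M : MOMDP X A d) (π : X → A → ℝ) : Prop :=
  ¬ ∃ π' : X → A → ℝ, IsPolicy π' ∧ (∀ i, Jret M π i ≤ Jret M π' i) ∧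
      ∃ j, Jret M π j < Jret M π' j

/-- The discounted state occupancy measure `ν^π`. -/
noncomputable def stateOcc {X A : Type} [Fintype X] [Fintype A] {d : ℕ}
    (M : MOMDP X A d) (π : X → A → ℝ) (x : X) : ℝ :=
  (1 - M.disc) * ∑' t : ℕ, M.disc ^ t * stateDist M π t x

/-- The discounted state-action occupancy measure `μ^π`. -/
noncomputable def occ {X A : Type} [Fintype X] [Fintype A] {d : ℕ}
    (M : MOMDP X A d) (π : X → A → ℝ) (p : X × A) : ℝ :=
  stateOcc M π p.1 * π p.1 p.2

/-- `ε`-approximate Pareto front property for a (randomized) output with expected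
return vector `EJ`. -/
def IsEpsPF {X A : Type} [Fintype X] [Fintype A] {d : ℕ}
    (M : MOMDP X A d) (EJ : Fin d → ℝ) (ε : ℝ) : Prop :=
  ¬ ∃ π : X → A → ℝ, IsPolicy π ∧ (∀ i, ε ≤ Jret M π i - EJ i) ∧
      ∃ j, ε < Jret M π j - EJ j

/-- A collection of `L` expert datasets, the `ℓ`-th containing `Nl ℓ` state-action pairs. -/
abbrev DataSets (L : ℕ) (Nl : Fin L → ℕ) (X A : Type) : Type :=
  ∀ ℓ : Fin L, Fin (Nl ℓ) → X × A

/-- Probability of observing the dataset collection `D` when, for each `ℓ`, the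
`Nl ℓ` samples of the `ℓ`-th dataset are drawn i.i.d. from the occupancy measure
`μ^{π_ℓ}` of the deterministic expert `π ℓ`. -/
noncomputable def dataProb {X A : Type} [Fintype X] [Fintype A] {d : ℕ} {L : ℕ}
    {Nl : Fin L → ℕ} (M : MOMDP X A d) (π : Fin L → X → A)
    (D : DataSets L Nl X A) : ℝ :=
  ∏ ℓ, ∏ n, occ M (detPolicy (π ℓ)) (D ℓ n)

/-- A state is diverging in the dataset collection `D` if two distinct experts were
observed taking different actions at it. -/
def divState {X A : Type} {L : ℕ} {Nl : Fin L → ℕ}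
    (D : DataSets L Nl X A) (x : X) : Prop :=
  ∃ ℓ ℓ' n n', ℓ ≠ ℓ' ∧ (D ℓ n).1 = x ∧ (D ℓ' n').1 = x ∧ (D ℓ n).2 ≠ (D ℓ' n').2

/-- Likelihood of the policy `π'` on the curated dataset `D_common ∪ D_ℓ`: a sample of
expert `ℓ'` is included iff `ℓ' = ℓ` or its state is not diverging.  (Maximizing this
likelihood is the same as maximizing the behavioral-cloning log-likelihood.) -/
noncomputable def curatedLik {X A : Type} {L : ℕ} {Nl : Fin L → ℕ}
    (D : DataSets L Nl X A) (ℓ : Fin L) (π' : X → A → ℝ) : ℝ :=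
  ∏ ℓ', ∏ n, if ℓ' = ℓ ∨ ¬ divState D (D ℓ' n).1
    then π' (D ℓ' n).1 (D ℓ' n).2 else 1

/-- A state appears in the curated dataset `D_common ∪ D_ℓ`. -/
def obsState {X A : Type} {L : ℕ} {Nl : Fin L → ℕ}
    (D : DataSets L Nl X A) (ℓ : Fin L) (x : X) : Prop :=
  ∃ ℓ' n, (ℓ' = ℓ ∨ ¬ divState D (D ℓ' n).1) ∧ (D ℓ' n).1 = x

/-- Cardinality of `X_common`, the set of states where all experts agree. -/
noncomputable def commonCard {X A : Type} [Fintype X] {L : ℕ}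
    (π : Fin L → X → A) : ℕ :=
  (Finset.univ.filter fun x => ∀ ℓ ℓ' : Fin L, π ℓ x = π ℓ' x).card

/-- The dataset-averaged state occupancy `ν^{π_data}(x) = (Σ_ℓ N_ℓ ν^{π_ℓ}(x)) / N`. -/
noncomputable def nuData {X A : Type} [Fintype X] [Fintype A] {d : ℕ} {L : ℕ}
    (M : MOMDP X A d) (Nl : Fin L → ℕ) (π : Fin L → X → A) (x : X) : ℝ :=
  (∑ ℓ, (Nl ℓ : ℝ) * stateOcc M (detPolicy (π ℓ)) x) / (∑ ℓ, (Nl ℓ : ℝ))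

/-- The concentrability coefficient `‖ν^{π_ℓ} / ν^{π_data}‖_∞`. -/
noncomputable def concentr {X A : Type} [Fintype X] [Fintype A] [Nonempty X] {d : ℕ}
    {L : ℕ} (M : MOMDP X A d) (Nl : Fin L → ℕ) (π : Fin L → X → A) (ℓ : Fin L) : ℝ :=
  Finset.univ.sup' Finset.univ_nonempty fun x =>
    stateOcc M (detPolicy (π ℓ)) x / nuData M Nl π x

/-- The MA-BC suboptimality level
`ε_ℓ = ‖ν^{π_ℓ}/ν^{π_data}‖_∞ |X_common| / (e (1-γ)² N) + |X \ X_common| / (e (1-γ)² N_ℓ)`. -/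
noncomputable def mabcEps {X A : Type} [Fintype X] [Fintype A] [Nonempty X] {d : ℕ}
    {L : ℕ} (M : MOMDP X A d) (Nl : Fin L → ℕ) (π : Fin L → X → A) (ℓ : Fin L) : ℝ :=
  concentr M Nl π ℓ * (commonCard π : ℝ) /
      (Real.exp 1 * (1 - M.disc) ^ 2 * ∑ ℓ', (Nl ℓ' : ℝ))
    + ((Fintype.card X : ℝ) - (commonCard π : ℝ)) /
      (Real.exp 1 * (1 - M.disc) ^ 2 * (Nl ℓ : ℝ))

/-- The body of the MA-BC sample-complexity corollary over a fixed pair of finite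
state/action spaces, for a candidate universal constant `c`. -/
def MABCCorollaryProp (X A : Type) [Fintype X] [Fintype A] [Nonempty X] (c : ℝ) : Prop :=
  ∀ (d : ℕ) (M : MOMDP X A d) (L : ℕ) (Nl : Fin L → ℕ), (∀ ℓ, 1 ≤ Nl ℓ) →
  ∀ π : Fin L → X → A, (∀ ℓ, IsPF M (detPolicy (π ℓ))) →
  ∀ hat : DataSets L Nl X A → Fin L → X → A → ℝ,
    (∀ D ℓ, IsPolicy (hat D ℓ)) →
    (∀ D ℓ (π' : X → A → ℝ), IsPolicy π' →
      curatedLik D ℓ π' ≤ curatedLik D ℓ (hat D ℓ)) →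
    (∀ D ℓ x, ¬ obsState D ℓ x → ∀ a, hat D ℓ x a = 1 / (Fintype.card A : ℝ)) →
  ∀ K : ℕ, K = Fintype.card X - commonCard π → 2 * K ≤ Fintype.card X →
  ∀ ε : ℝ, 0 < ε →
    (c * (⨆ ℓ : Fin L, concentr M Nl π ℓ) * (Fintype.card X : ℝ) /
        ((1 - M.disc) ^ 2 * ε) ≤ ∑ ℓ, (Nl ℓ : ℝ)) →
    (∀ ℓ, c * (K : ℝ) / ((1 - M.disc) ^ 2 * ε) ≤ (Nl ℓ : ℝ)) →
    ∀ ℓ, IsEpsPF M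
      (fun i => ∑ D : DataSets L Nl X A, dataProb M π D * Jret M (hat D ℓ) i) ε


section Helpers

lemma aux_prod_sum {ι : Type} [Fintype ι] [DecidableEq ι] {κ : ι → Type}
    [∀ i, Fintype (κ i)] (f : ∀ i, κ i → ℝ) :
    ∑ x : (∀ i, κ i), ∏ i, f i (x i) = ∏ i, ∑ j, f i j := by
  rw [Finset.prod_univ_sum, Fintype.piFinset_univ]

lemma aux_data_sum {X A : Type} [Fintype X] [Fintype A] {L : ℕ} {Nl : Fin L → ℕ}
    (f : Fin L → X × A → ℝ) :
    ∑ D : DataSets L Nl X A, ∏ ℓ, ∏ n, f ℓ (D ℓ n) = ∏ ℓ, (∑ p, f ℓ p) ^ (Nl ℓ) := by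
  have h := aux_prod_sum (ι := Fin L) (κ := fun ℓ => Fin (Nl ℓ) → X × A)
    (fun ℓ g => ∏ n, f ℓ (g n))
  have h2 : ∀ ℓ, ∑ g : Fin (Nl ℓ) → X × A, ∏ n, f ℓ (g n) = (∑ p, f ℓ p) ^ (Nl ℓ) := by
    intro ℓ
    have := aux_prod_sum (ι := Fin (Nl ℓ)) (κ := fun _ => X × A) (fun _ p => f ℓ p)
    simp only [Finset.prod_const, Finset.card_univ, Fintype.card_fin] at this
    convert this
  simp only [h2] at h
  convert h

variable {X A : Type} [Fintype X] [Fintype A] {d : ℕ}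

lemma aux_det_policy (f : X → A) : IsPolicy (detPolicy f) := by
  refine ⟨fun x a => ?_, fun x => ?_⟩
  · unfold detPolicy; split_ifs <;> norm_num
  · unfold detPolicy; simp

lemma aux_sd_nonneg (M : MOMDP X A d) {π : X → A → ℝ} (hπ : IsPolicy π) (t : ℕ) :
    ∀ x, 0 ≤ stateDist M π t x := by
  induction t with
  | zero => exact M.init_nonneg
  | succ t ih =>
    intro x
    simp only [stateDist]
    exact Finset.sum_nonneg fun y _ => Finset.sum_nonneg fun a _ =>
      mul_nonneg (mul_nonneg (ih y) (hπ.1 y a)) (M.P_nonneg y a x)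

lemma aux_sd_sum (M : MOMDP X A d) {π : X → A → ℝ} (hπ : IsPolicy π) (t : ℕ) :
    ∑ x, stateDist M π t x = 1 := by
  induction t with
  | zero => exact M.init_sum_one
  | succ t ih =>
    simp only [stateDist]
    rw [Finset.sum_comm]
    rw [← ih]
    refine Finset.sum_congr rfl fun y _ => ?_
    rw [Finset.sum_comm]
    simp only [← Finset.mul_sum, M.P_sum_one, mul_one, hπ.2]

lemma aux_sd_le (M : MOMDP X A d) {π : X → A → ℝ} (hπ : IsPolicy π) (t : ℕ) (x : X) :
    stateDist M π t x ≤ 1 := by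
  rw [← aux_sd_sum M hπ t]
  exact Finset.single_le_sum (fun y _ => aux_sd_nonneg M hπ t y) (Finset.mem_univ x)

lemma aux_summable (M : MOMDP X A d) (f : ℕ → ℝ) (h0 : ∀ t, 0 ≤ f t) (h1 : ∀ t, f t ≤ 1) :
    Summable fun t => M.disc ^ t * f t :=
  Summable.of_nonneg_of_le (fun t => mul_nonneg (pow_nonneg M.disc_nonneg t) (h0 t))
    (fun t => mul_le_of_le_one_right (pow_nonneg M.disc_nonneg t) (h1 t))
    (summable_geometric_of_lt_one M.disc_nonneg M.disc_lt_one)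

lemma aux_occ_nonneg (M : MOMDP X A d) {π : X → A → ℝ} (hπ : IsPolicy π) (x : X) :
    0 ≤ stateOcc M π x :=
  mul_nonneg (by linarith [M.disc_lt_one]) (tsum_nonneg fun t =>
    mul_nonneg (pow_nonneg M.disc_nonneg t) (aux_sd_nonneg M hπ t x))

/-- occupancy of a finset -/
lemma aux_occ_set (M : MOMDP X A d) {π : X → A → ℝ} (hπ : IsPolicy π) (B : Finset X) :
    ∑ x ∈ B, stateOcc M π x
      = (1 - M.disc) * ∑' t : ℕ, M.disc ^ t * ∑ x ∈ B, stateDist M π t x := by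
  unfold stateOcc
  rw [← Finset.mul_sum]
  congr 1
  simp only [Finset.mul_sum]
  rw [Summable.tsum_finsetSum]
  exact fun x _ => aux_summable M _ (fun t => aux_sd_nonneg M hπ t x)
    (fun t => aux_sd_le M hπ t x)

lemma aux_occ_sum (M : MOMDP X A d) {π : X → A → ℝ} (hπ : IsPolicy π) :
    ∑ x, stateOcc M π x = 1 := by
  rw [aux_occ_set M hπ]
  simp only [aux_sd_sum M hπ, mul_one]
  rw [tsum_geometric_of_lt_one M.disc_nonneg M.disc_lt_one]
  exact mul_inv_cancel₀ (by linarith [M.disc_lt_one])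

lemma aux_rew (M : MOMDP X A d) {π : X → A → ℝ} (hπ : IsPolicy π) (i : Fin d) (t : ℕ) :
    0 ≤ ∑ x, ∑ a, stateDist M π t x * π x a * M.r x a i ∧
    ∑ x, ∑ a, stateDist M π t x * π x a * M.r x a i ≤ 1 := by
  have hp := aux_sd_nonneg M hπ t
  constructor
  · exact Finset.sum_nonneg fun y _ => Finset.sum_nonneg fun a _ =>
      mul_nonneg (mul_nonneg (hp y) (hπ.1 y a)) (M.r_nonneg y a i)
  · rw [← aux_sd_sum M hπ t]
    refine Finset.sum_le_sum fun y _ => ?_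
    calc _ ≤ ∑ a, stateDist M π t y * π y a := Finset.sum_le_sum fun a _ =>
          mul_le_of_le_one_right (mul_nonneg (hp y) (hπ.1 y a)) (M.r_le_one y a i)
      _ = _ := by rw [← Finset.mul_sum, hπ.2, mul_one]

/-- pointwise bound on the joint difference -/
lemma aux_joint (M : MOMDP X A d) {π ρ : X → A → ℝ} (hπ : IsPolicy π) (hρ : IsPolicy ρ)
    (B : Finset X) (hB : ∀ x, x ∉ B → ρ x = π x) (t : ℕ) (w : X → A → ℝ)
    (hw : ∀ x a, 0 ≤ w x a) :
    ∑ x, ∑ a, stateDist M π t x * π x a * w x a - ∑ x, ∑ a, stateDist M ρ t x * ρ x a * w x a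
      ≤ ∑ x, ∑ a, (max (stateDist M π t x - stateDist M ρ t x) 0 +
        (if x ∈ B then stateDist M π t x else 0)) * π x a * w x a := by
  have hp := aux_sd_nonneg M hπ t
  have hq := aux_sd_nonneg M hρ t
  simp only [← Finset.sum_sub_distrib]
  refine Finset.sum_le_sum fun x _ => Finset.sum_le_sum fun a _ => ?_
  rw [← sub_mul]
  refine mul_le_mul_of_nonneg_right ?_ (hw x a)
  have hm := le_max_left (stateDist M π t x - stateDist M ρ t x) 0
  have hm0 := le_max_right (stateDist M π t x - stateDist M ρ t x) 0
  have h1 := hπ.1 x a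
  have h2 := mul_nonneg (hq x) (hρ.1 x a)
  have h3 := mul_nonneg hm0 h1
  split_ifs with h
  · rw [add_mul]; linarith
  · rw [hB x h, add_zero, ← sub_mul]
    exact mul_le_mul_of_nonneg_right hm h1

lemma aux_perf (M : MOMDP X A d) {π ρ : X → A → ℝ} (hπ : IsPolicy π) (hρ : IsPolicy ρ)
    (B : Finset X) (hB : ∀ x, x ∉ B → ρ x = π x) (i : Fin d) :
    Jret M π i - Jret M ρ i ≤ (∑ x ∈ B, stateOcc M π x) / (1 - M.disc) ^ 2 := by
  have hγ0 := M.disc_nonneg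
  have hγ : 0 < 1 - M.disc := by linarith [M.disc_lt_one]
  set b : ℕ → ℝ := fun t => ∑ x ∈ B, stateDist M π t x with hb
  set S : ℕ → ℝ := fun t => ∑ x, max (stateDist M π t x - stateDist M ρ t x) 0 with hS
  have hb0 : ∀ t, 0 ≤ b t := fun t => Finset.sum_nonneg fun x _ => aux_sd_nonneg M hπ t x
  have hb1 : ∀ t, b t ≤ 1 := fun t => by
    rw [← aux_sd_sum M hπ t]
    exact Finset.sum_le_sum_of_subset_of_nonneg (Finset.subset_univ _)
      fun x _ _ => aux_sd_nonneg M hπ t x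
  have hS0 : ∀ t, 0 ≤ S t := fun t => Finset.sum_nonneg fun x _ => le_max_right _ _
  have hS1 : ∀ t, S t ≤ 1 := fun t => by
    rw [← aux_sd_sum M hπ t]
    refine Finset.sum_le_sum fun x _ => max_le ?_ (aux_sd_nonneg M hπ t x)
    linarith [aux_sd_nonneg M hρ t x]
  have hz : S 0 = 0 := by simp [hS, stateDist]
  have hSb : ∀ t, ∑ x, (max (stateDist M π t x - stateDist M ρ t x) 0 +
        (if x ∈ B then stateDist M π t x else 0)) = S t + b t := by
    intro t
    rw [Finset.sum_add_distrib]
    simp [hS, hb]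
  have hnn : ∀ t x a, 0 ≤ (max (stateDist M π t x - stateDist M ρ t x) 0 +
        (if x ∈ B then stateDist M π t x else 0)) * π x a := by
    intro t x a
    refine mul_nonneg (add_nonneg (le_max_right _ _) ?_) (hπ.1 x a)
    split_ifs
    · exact aux_sd_nonneg M hπ t x
    · exact le_rfl
  have hstep : ∀ t, S (t + 1) ≤ S t + b t := by
    intro t
    calc S (t + 1) ≤ ∑ x', ∑ x, ∑ a, (max (stateDist M π t x - stateDist M ρ t x) 0 +
        (if x ∈ B then stateDist M π t x else 0)) * π x a * M.P x a x' := by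
          refine Finset.sum_le_sum fun x' _ => max_le ?_ ?_
          · exact aux_joint M hπ hρ B hB t (fun x a => M.P x a x') (fun x a => M.P_nonneg x a x')
          · exact Finset.sum_nonneg fun x _ => Finset.sum_nonneg fun a _ =>
              mul_nonneg (hnn t x a) (M.P_nonneg x a x')
      _ = S t + b t := by
          rw [← hSb t, Finset.sum_comm]
          refine Finset.sum_congr rfl fun x _ => ?_
          rw [Finset.sum_comm]
          simp only [← Finset.mul_sum, M.P_sum_one, mul_one, hπ.2]
  have hrew : ∀ t, ∑ x, ∑ a, stateDist M π t x * π x a * M.r x a i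
      - ∑ x, ∑ a, stateDist M ρ t x * ρ x a * M.r x a i ≤ S t + b t := by
    intro t
    refine (aux_joint M hπ hρ B hB t (fun x a => M.r x a i) (fun x a => M.r_nonneg x a i)).trans ?_
    rw [← hSb t]
    refine Finset.sum_le_sum fun x _ => ?_
    calc _ ≤ ∑ a, (max (stateDist M π t x - stateDist M ρ t x) 0 +
        (if x ∈ B then stateDist M π t x else 0)) * π x a := Finset.sum_le_sum fun a _ =>
          mul_le_of_le_one_right (hnn t x a) (M.r_le_one x a i)
      _ = _ := by rw [← Finset.mul_sum, hπ.2, mul_one]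
  have sS := aux_summable M S hS0 hS1
  have sb := aux_summable M b hb0 hb1
  have sJ1 := aux_summable M _ (fun t => (aux_rew M hπ i t).1) (fun t => (aux_rew M hπ i t).2)
  have sJ2 := aux_summable M _ (fun t => (aux_rew M hρ i t).1) (fun t => (aux_rew M hρ i t).2)
  have e1 : Jret M π i - Jret M ρ i ≤ (∑' t, M.disc ^ t * S t) + ∑' t, M.disc ^ t * b t := by
    unfold Jret
    rw [← sJ1.tsum_sub sJ2, ← sS.tsum_add sb]
    refine (sJ1.sub sJ2).tsum_le_tsum (fun t => ?_) (sS.add sb)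
    rw [← mul_sub, ← mul_add]
    exact mul_le_mul_of_nonneg_left (hrew t) (pow_nonneg hγ0 t)
  have e2 : (∑' t, M.disc ^ t * S t) ≤
      M.disc * ((∑' t, M.disc ^ t * S t) + ∑' t, M.disc ^ t * b t) := by
    conv_lhs => rw [sS.tsum_eq_zero_add]
    rw [hz, mul_zero, zero_add, ← sS.tsum_add sb, ← tsum_mul_left]
    refine ((summable_nat_add_iff 1).2 sS).tsum_le_tsum (fun t => ?_) ((sS.add sb).mul_left _)
    rw [← mul_add, ← mul_assoc, pow_succ, mul_comm (M.disc ^ t) M.disc]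
    exact mul_le_mul_of_nonneg_left (hstep t) (mul_nonneg hγ0 (pow_nonneg hγ0 t))
  rw [aux_occ_set M hπ B]
  set s := ∑' t, M.disc ^ t * S t
  set β := ∑' t, M.disc ^ t * b t with hβ
  rw [le_div_iff₀ (by positivity)]
  have e3 : (s + β) * (1 - M.disc) ≤ β := by nlinarith
  calc _ ≤ (s + β) * (1 - M.disc) ^ 2 := mul_le_mul_of_nonneg_right e1 (by positivity)
    _ = (1 - M.disc) * ((s + β) * (1 - M.disc)) := by ring
    _ ≤ _ := mul_le_mul_of_nonneg_left e3 hγ.le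

/-- samples of positive probability follow the expert -/
lemma aux_support {L : ℕ} {Nl : Fin L → ℕ} (M : MOMDP X A d) (π : Fin L → X → A)
    (D : DataSets L Nl X A) (hD : dataProb M π D ≠ 0) (ℓ : Fin L) (n : Fin (Nl ℓ)) :
    (D ℓ n).2 = π ℓ (D ℓ n).1 := by
  unfold dataProb at hD
  have h1 := Finset.prod_ne_zero_iff.1 hD ℓ (Finset.mem_univ _)
  have h2 := Finset.prod_ne_zero_iff.1 h1 n (Finset.mem_univ _)
  by_contra h
  exact h2 (by simp [occ, detPolicy, h])

lemma aux_dataProb_nonneg {L : ℕ} {Nl : Fin L → ℕ} (M : MOMDP X A d) (π : Fin L → X → A)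
    (D : DataSets L Nl X A) : 0 ≤ dataProb M π D :=
  Finset.prod_nonneg fun ℓ _ => Finset.prod_nonneg fun n _ =>
    mul_nonneg (aux_occ_nonneg M (aux_det_policy _) _) ((aux_det_policy (π ℓ)).1 _ _)

lemma aux_prod_one {ι : Type} [Fintype ι] (f : ι → ℝ) (h0 : ∀ i, 0 ≤ f i) (h1 : ∀ i, f i ≤ 1)
    (h : 1 ≤ ∏ i, f i) (i : ι) : 1 ≤ f i := by
  rw [← Finset.mul_prod_erase _ _ (Finset.mem_univ i)] at h
  exact h.trans (mul_le_of_le_one_right (h0 i)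
    (Finset.prod_le_one (fun j _ => h0 j) (fun j _ => h1 j)))

lemma aux_pol_le_one {ρ : X → A → ℝ} (hρ : IsPolicy ρ) (x : X) (a : A) : ρ x a ≤ 1 := by
  rw [← hρ.2 x]
  exact Finset.single_le_sum (fun b _ => hρ.1 x b) (Finset.mem_univ a)

lemma aux_pol_det {ρ : X → A → ℝ} (hρ : IsPolicy ρ) (x : X) (f : X → A) (h : 1 ≤ ρ x (f x)) :
    ρ x = detPolicy f x := by
  have h1 : ρ x (f x) = 1 := le_antisymm (aux_pol_le_one hρ x _) h
  have h2 := hρ.2 x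
  rw [← Finset.add_sum_erase _ _ (Finset.mem_univ (f x)), h1] at h2
  have h3 : ∑ a ∈ Finset.univ.erase (f x), ρ x a = 0 := by linarith
  rw [Finset.sum_eq_zero_iff_of_nonneg fun a _ => hρ.1 x a] at h3
  funext a
  unfold detPolicy
  split_ifs with h
  · rw [h, h1]
  · exact h3 a (by simp [h])

lemma aux_bc {L : ℕ} {Nl : Fin L → ℕ} (M : MOMDP X A d) (π : Fin L → X → A)
    (D : DataSets L Nl X A) (hD : dataProb M π D ≠ 0) (ℓ : Fin L) (ρ : X → A → ℝ)
    (hρ : IsPolicy ρ)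
    (hmax : ∀ π' : X → A → ℝ, IsPolicy π' → curatedLik D ℓ π' ≤ curatedLik D ℓ ρ)
    (ℓ' : Fin L) (n : Fin (Nl ℓ')) (hinc : ℓ' = ℓ ∨ ¬ divState D (D ℓ' n).1) :
    1 ≤ ρ (D ℓ' n).1 (D ℓ' n).2 := by
  let g : X → A := fun x =>
    if h : ∃ q : (Σ ℓ' : Fin L, Fin (Nl ℓ')), ¬ divState D x ∧ (D q.1 q.2).1 = x then
      (D h.choose.1 h.choose.2).2 else π ℓ x
  have hg : curatedLik D ℓ (detPolicy g) = 1 := by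
    unfold curatedLik
    refine Finset.prod_eq_one fun k _ => Finset.prod_eq_one fun m _ => ?_
    split_ifs with hi
    · have : (D k m).2 = g (D k m).1 := by
        by_cases hdv : divState D (D k m).1
        · have hk : k = ℓ := by tauto
          subst hk
          simp only [g]
          rw [dif_neg (by rintro ⟨q, hq, -⟩; exact hq hdv)]
          exact aux_support M π D hD k m
        · have hex : ∃ q : (Σ ℓ' : Fin L, Fin (Nl ℓ')),
            ¬ divState D (D k m).1 ∧ (D q.1 q.2).1 = (D k m).1 := ⟨⟨k, m⟩, hdv, rfl⟩
          simp only [g]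
          rw [dif_pos hex]
          have hs := hex.choose_spec
          generalize hex.choose = q at hs ⊢
          obtain ⟨k', m'⟩ := q
          by_contra hne
          by_cases hkk : k = k'
          · subst hkk
            apply hne
            rw [aux_support M π D hD k m, aux_support M π D hD k m']
            exact congrArg _ hs.2.symm
          · exact hdv ⟨k, k', m, m', hkk, rfl, hs.2, hne⟩
      simp [detPolicy, this]
    · rfl
  have h1 : 1 ≤ curatedLik D ℓ ρ := hg ▸ hmax _ (aux_det_policy g)
  unfold curatedLik at h1
  have f0 : ∀ k m, 0 ≤ (if k = ℓ ∨ ¬ divState D (D k m).1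
    then ρ (D k m).1 (D k m).2 else 1) := by
    intro k m; split_ifs
    · exact hρ.1 _ _
    · norm_num
  have f1 : ∀ k m, (if k = ℓ ∨ ¬ divState D (D k m).1
    then ρ (D k m).1 (D k m).2 else 1) ≤ 1 := by
    intro k m; split_ifs
    · exact aux_pol_le_one hρ _ _
    · norm_num
  have h2 := aux_prod_one _ (fun k => Finset.prod_nonneg fun m _ => f0 k m)
    (fun k => Finset.prod_le_one (fun m _ => f0 k m) (fun m _ => f1 k m)) h1 ℓ'
  have h3 := aux_prod_one _ (f0 ℓ') (f1 ℓ') h2 n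
  rwa [if_pos hinc] at h3

lemma aux_occ_pair_sum (M : MOMDP X A d) (f : X → A) :
    ∑ p : X × A, occ M (detPolicy f) p = 1 := by
  rw [Fintype.sum_prod_type]
  simp only [occ, ← Finset.mul_sum, (aux_det_policy f).2, mul_one]
  exact aux_occ_sum M (aux_det_policy f)

lemma aux_occ_pair_ne (M : MOMDP X A d) (f : X → A) (x : X) :
    ∑ p : X × A, occ M (detPolicy f) p * (if p.1 ≠ x then 1 else 0)
      = 1 - stateOcc M (detPolicy f) x := by
  rw [Fintype.sum_prod_type]
  have : ∀ y, ∑ a, occ M (detPolicy f) (y, a) * (if (y, a).1 ≠ x then (1 : ℝ) else 0)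
      = stateOcc M (detPolicy f) y - (if y = x then stateOcc M (detPolicy f) y else 0) := by
    intro y
    have hs : ∑ a, occ M (detPolicy f) (y, a) = stateOcc M (detPolicy f) y := by
      simp only [occ, ← Finset.mul_sum, (aux_det_policy f).2, mul_one]
    by_cases h : y = x
    · simp [h]
    · simp [h, hs]
  simp only [this]
  rw [Finset.sum_sub_distrib, aux_occ_sum M (aux_det_policy f)]
  simp

lemma aux_unseen {L : ℕ} {Nl : Fin L → ℕ} (M : MOMDP X A d) (π : Fin L → X → A)
    (S : Finset (Fin L)) (x : X) :
    ∑ D : DataSets L Nl X A, dataProb M π D *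
      (if ∀ ℓ ∈ S, ∀ n, (D ℓ n).1 ≠ x then 1 else 0)
      ≤ Real.exp (-∑ ℓ ∈ S, (Nl ℓ : ℝ) * stateOcc M (detPolicy (π ℓ)) x) := by
  have h := aux_data_sum (Nl := Nl) (fun (ℓ : Fin L) (p : X × A) =>
    occ M (detPolicy (π ℓ)) p * (if ℓ ∈ S then (if p.1 ≠ x then 1 else 0) else 1))
  have h1 : ∀ D : DataSets L Nl X A, dataProb M π D *
      (if ∀ ℓ ∈ S, ∀ n, (D ℓ n).1 ≠ x then 1 else 0) =
      ∏ ℓ, ∏ n, (occ M (detPolicy (π ℓ)) (D ℓ n) *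
        (if ℓ ∈ S then (if (D ℓ n).1 ≠ x then 1 else 0) else 1)) := by
    intro D
    simp only [Finset.prod_mul_distrib]
    unfold dataProb
    congr 1
    split_ifs with hc
    · symm
      refine Finset.prod_eq_one fun ℓ _ => Finset.prod_eq_one fun n _ => ?_
      by_cases hℓ : ℓ ∈ S
      · simp [hℓ, hc ℓ hℓ n]
      · simp [hℓ]
    · push Not at hc
      obtain ⟨ℓ, hℓ, n, hn⟩ := hc
      symm
      refine Finset.prod_eq_zero (Finset.mem_univ ℓ) (Finset.prod_eq_zero (Finset.mem_univ n) ?_)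
      simp [hℓ, hn]
  rw [Finset.sum_congr rfl fun D _ => h1 D, h, ← Finset.sum_neg_distrib, Real.exp_sum,
    ← Finset.prod_subset (Finset.subset_univ S)]
  · refine Finset.prod_le_prod ?_ ?_
    · intro ℓ _
      refine pow_nonneg (Finset.sum_nonneg fun p _ => mul_nonneg
        (mul_nonneg (aux_occ_nonneg M (aux_det_policy _) _) ((aux_det_policy (π ℓ)).1 _ _)) ?_) _
      split_ifs <;> norm_num
    · intro ℓ hℓ
      simp only [hℓ, if_true]
      rw [aux_occ_pair_ne, ← mul_neg, Real.exp_nat_mul]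
      refine pow_le_pow_left₀ ?_ ?_ _
      · rw [sub_nonneg, ← aux_occ_sum M (aux_det_policy (π ℓ))]
        exact Finset.single_le_sum (fun y _ => aux_occ_nonneg M (aux_det_policy _) y)
          (Finset.mem_univ x)
      · have := Real.add_one_le_exp (-stateOcc M (detPolicy (π ℓ)) x)
        linarith
  · intro ℓ _ hℓ
    simp only [hℓ, if_false, mul_one]
    rw [aux_occ_pair_sum, one_pow]

lemma aux_dataProb_sum {L : ℕ} {Nl : Fin L → ℕ} (M : MOMDP X A d) (π : Fin L → X → A) :
    ∑ D : DataSets L Nl X A, dataProb M π D = 1 := by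
  have h := aux_data_sum (Nl := Nl) (fun (ℓ : Fin L) (p : X × A) => occ M (detPolicy (π ℓ)) p)
  simp only [aux_occ_pair_sum, one_pow, Finset.prod_const_one] at h
  exact h

lemma aux_xexp (y : ℝ) : y * Real.exp (-y) ≤ 1 := by
  rw [Real.exp_neg, ← div_eq_mul_inv, div_le_one (Real.exp_pos y)]
  linarith [Real.add_one_le_exp y]

/-- The set of experts whose data is informative at `x` for expert `ℓ`. -/
noncomputable def auxS {L : ℕ} (π : Fin L → X → A) (ℓ : Fin L) (x : X) : Finset (Fin L) :=
  if ∀ k k' : Fin L, π k x = π k' x then Finset.univ else {ℓ}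

lemma aux_gap {L : ℕ} {Nl : Fin L → ℕ} (M : MOMDP X A d) (π : Fin L → X → A)
    (hat : DataSets L Nl X A → Fin L → X → A → ℝ)
    (hpol : ∀ D ℓ, IsPolicy (hat D ℓ))
    (hmax : ∀ D ℓ (π' : X → A → ℝ), IsPolicy π' →
      curatedLik D ℓ π' ≤ curatedLik D ℓ (hat D ℓ)) (ℓ : Fin L) (i : Fin d) :
    Jret M (detPolicy (π ℓ)) i - ∑ D : DataSets L Nl X A, dataProb M π D * Jret M (hat D ℓ) i
      ≤ (∑ x, stateOcc M (detPolicy (π ℓ)) x *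
        Real.exp (-∑ k ∈ auxS π ℓ x, (Nl k : ℝ) * stateOcc M (detPolicy (π k)) x))
        / (1 - M.disc) ^ 2 := by
  have hγ : 0 < 1 - M.disc := by linarith [M.disc_lt_one]
  have hstep : ∀ D : DataSets L Nl X A,
      dataProb M π D * (Jret M (detPolicy (π ℓ)) i - Jret M (hat D ℓ) i) ≤
      dataProb M π D * ((∑ x, stateOcc M (detPolicy (π ℓ)) x *
        (if ∀ k ∈ auxS π ℓ x, ∀ n, (D k n).1 ≠ x then 1 else 0)) / (1 - M.disc) ^ 2) := by
    intro D
    by_cases hD : dataProb M π D = 0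
    · simp [hD]
    refine mul_le_mul_of_nonneg_left ?_ (aux_dataProb_nonneg M π D)
    have := aux_perf M (aux_det_policy (π ℓ)) (hpol D ℓ)
      (Finset.univ.filter fun x => ∀ k ∈ auxS π ℓ x, ∀ n, (D k n).1 ≠ x) ?_ i
    · rw [Finset.sum_filter] at this
      simpa only [mul_ite, mul_one, mul_zero] using this
    · intro x hx
      simp only [Finset.mem_filter, Finset.mem_univ, true_and] at hx
      push Not at hx
      obtain ⟨k, hk, n, hn⟩ := hx
      apply aux_pol_det (hpol D ℓ)
      have hkx : π k x = π ℓ x ∧ (k = ℓ ∨ ¬ divState D (D k n).1) := by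
        unfold auxS at hk
        split_ifs at hk with hc
        · refine ⟨hc _ _, Or.inr ?_⟩
          rw [hn]
          rintro ⟨a, b, m, m', -, h1, h2, h3⟩
          apply h3
          rw [aux_support M π D hD a m, aux_support M π D hD b m', h1, h2]
          exact hc a b
        · rw [Finset.mem_singleton] at hk
          exact ⟨by rw [hk], Or.inl hk⟩
      have := aux_bc M π D hD ℓ (hat D ℓ) (hpol D ℓ) (hmax D ℓ) k n hkx.2
      rwa [aux_support M π D hD k n, hn, hkx.1] at this
  have e1 : Jret M (detPolicy (π ℓ)) i - ∑ D : DataSets L Nl X A,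
      dataProb M π D * Jret M (hat D ℓ) i = ∑ D : DataSets L Nl X A,
      dataProb M π D * (Jret M (detPolicy (π ℓ)) i - Jret M (hat D ℓ) i) := by
    simp only [mul_sub, Finset.sum_sub_distrib]
    rw [← Finset.sum_mul, aux_dataProb_sum, one_mul]
  rw [e1]
  refine (Finset.sum_le_sum fun D _ => hstep D).trans ?_
  simp only [← mul_div_assoc]
  rw [← Finset.sum_div]
  refine div_le_div_of_nonneg_right ?_ (by positivity)
  simp only [Finset.mul_sum]
  rw [Finset.sum_comm]
  refine Finset.sum_le_sum fun x _ => ?_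
  refine le_trans (le_of_eq ?_) (mul_le_mul_of_nonneg_left (aux_unseen M π (auxS π ℓ x) x)
    (aux_occ_nonneg M (aux_det_policy (π ℓ)) x))
  rw [Finset.mul_sum]
  exact Finset.sum_congr rfl fun D _ => by ring

lemma aux_term [Nonempty X] {L : ℕ} {Nl : Fin L → ℕ} (hN : ∀ ℓ, 1 ≤ Nl ℓ) (M : MOMDP X A d)
    (π : Fin L → X → A) (ℓ : Fin L) (x : X) :
    stateOcc M (detPolicy (π ℓ)) x *
        Real.exp (-∑ k ∈ auxS π ℓ x, (Nl k : ℝ) * stateOcc M (detPolicy (π k)) x) ≤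
      if ∀ k k' : Fin L, π k x = π k' x then
        concentr M Nl π ℓ / ∑ k, (Nl k : ℝ) else 1 / (Nl ℓ : ℝ) := by
  have hNl : ∀ k, (0 : ℝ) < Nl k := fun k => by exact_mod_cast hN k
  have hNt : (0 : ℝ) < ∑ k, (Nl k : ℝ) := Finset.sum_pos (fun k _ => hNl k) ⟨ℓ, Finset.mem_univ _⟩
  have ho := fun k => aux_occ_nonneg M (aux_det_policy (π k))
  unfold auxS
  split_ifs with hc
  · have hle : stateOcc M (detPolicy (π ℓ)) x / nuData M Nl π x ≤ concentr M Nl π ℓ :=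
      Finset.le_sup' (fun x => stateOcc M (detPolicy (π ℓ)) x / nuData M Nl π x)
        (Finset.mem_univ x)
    set T := ∑ k, (Nl k : ℝ) * stateOcc M (detPolicy (π k)) x with hT
    have hT0 : 0 ≤ T := Finset.sum_nonneg fun k _ => mul_nonneg (hNl k).le (ho k x)
    have hnu : nuData M Nl π x = T / ∑ k, (Nl k : ℝ) := rfl
    rcases hT0.eq_or_lt with h0 | h0
    · have hz : stateOcc M (detPolicy (π ℓ)) x = 0 := by
        have := (Finset.sum_eq_zero_iff_of_nonneg
          fun k _ => mul_nonneg (hNl k).le (ho k x)).1 h0.symm ℓ (Finset.mem_univ _)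
        exact (mul_eq_zero.1 this).resolve_left (hNl ℓ).ne'
      rw [hz, zero_mul]
      rw [hz, zero_div] at hle
      exact div_nonneg hle hNt.le
    · rw [hnu] at hle
      have hC : 0 ≤ concentr M Nl π ℓ := (div_nonneg (ho ℓ x) (div_nonneg hT0 hNt.le)).trans hle
      rw [div_le_iff₀ (div_pos h0 hNt)] at hle
      calc _ ≤ concentr M Nl π ℓ * (T / ∑ k, (Nl k : ℝ)) * Real.exp (-T) :=
            mul_le_mul_of_nonneg_right hle (Real.exp_pos _).le
        _ = concentr M Nl π ℓ / (∑ k, (Nl k : ℝ)) * (T * Real.exp (-T)) := by ring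
        _ ≤ _ := mul_le_of_le_one_right (div_nonneg hC hNt.le) (aux_xexp T)
  · rw [Finset.sum_singleton, le_div_iff₀ (hNl ℓ)]
    have := aux_xexp ((Nl ℓ : ℝ) * stateOcc M (detPolicy (π ℓ)) x)
    linarith

lemma aux_main [Nonempty X] : MABCCorollaryProp X A 2 := by
  intro d M L Nl hN π hPF hat hpol hmax _ K hK _ ε hε hNtot hNind ℓ
  have hγ : 0 < 1 - M.disc := by linarith [M.disc_lt_one]
  have hγ2 : 0 < (1 - M.disc) ^ 2 := by positivity
  have hNl : ∀ k, (0 : ℝ) < Nl k := fun k => by exact_mod_cast hN k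
  have hNt : (0 : ℝ) < ∑ k, (Nl k : ℝ) := Finset.sum_pos (fun k _ => hNl k) ⟨ℓ, Finset.mem_univ _⟩
  have hC : concentr M Nl π ℓ ≤ ⨆ ℓ : Fin L, concentr M Nl π ℓ :=
    le_ciSup (Set.finite_range fun ℓ => concentr M Nl π ℓ).bddAbove ℓ
  set C := ⨆ ℓ : Fin L, concentr M Nl π ℓ
  have hC0 : 0 ≤ concentr M Nl π ℓ := by
    obtain ⟨x⟩ := ‹Nonempty X›
    have ho := fun k => aux_occ_nonneg M (aux_det_policy (π k)) x
    refine le_trans ?_ (Finset.le_sup' (fun x => stateOcc M (detPolicy (π ℓ)) x / nuData M Nl π x)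
        (Finset.mem_univ x))
    exact div_nonneg (ho ℓ) (div_nonneg
      (Finset.sum_nonneg fun k _ => mul_nonneg (hNl k).le (ho k)) hNt.le)
  have hgap : ∀ i, Jret M (detPolicy (π ℓ)) i -
      ∑ D : DataSets L Nl X A, dataProb M π D * Jret M (hat D ℓ) i ≤ ε := by
    intro i
    refine (aux_gap M π hat hpol hmax ℓ i).trans ?_
    rw [div_le_iff₀ hγ2]
    refine (Finset.sum_le_sum fun x _ => aux_term hN M π ℓ x).trans ?_
    rw [Finset.sum_ite, Finset.sum_const, Finset.sum_const, nsmul_eq_mul, nsmul_eq_mul]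
    have hcK : (Finset.univ.filter fun x => ¬ ∀ k k' : Fin L, π k x = π k' x).card = K := by
      have := Finset.card_filter_add_card_filter_not (s := (Finset.univ : Finset X))
        (fun x => ∀ k k' : Fin L, π k x = π k' x)
      rw [Finset.card_univ] at this
      unfold commonCard at hK
      omega
    rw [hcK]
    have hcX : ((Finset.univ.filter fun x => ∀ k k' : Fin L, π k x = π k' x).card : ℝ)
        ≤ Fintype.card X := by exact_mod_cast Finset.card_le_univ _
    have t1 : ((Finset.univ.filter fun x => ∀ k k' : Fin L, π k x = π k' x).card : ℝ) *
        (concentr M Nl π ℓ / ∑ k, (Nl k : ℝ)) ≤ (1 - M.disc) ^ 2 * ε / 2 := by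
      rw [div_le_iff₀ (by positivity)] at hNtot
      rw [← mul_div_assoc, div_le_iff₀ hNt]
      have : ((Finset.univ.filter fun x => ∀ k k' : Fin L, π k x = π k' x).card : ℝ) *
        concentr M Nl π ℓ ≤ Fintype.card X * C := mul_le_mul hcX hC hC0 (by positivity)
      linarith
    have t2 : (K : ℝ) * (1 / (Nl ℓ : ℝ)) ≤ (1 - M.disc) ^ 2 * ε / 2 := by
      have := hNind ℓ
      rw [div_le_iff₀ (by positivity)] at this
      rw [mul_one_div, div_le_iff₀ (hNl ℓ)]
      linarith
    linarith
  rintro ⟨ρ, hρ, hall, j, hj⟩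
  refine hPF ℓ ⟨ρ, hρ, fun i => ?_, j, ?_⟩
  · linarith [hgap i, hall i]
  · linarith [hgap j]

end Helpers

/-- **MA-BC sample complexity (corollary).** There is a universal constant `c > 0` such
that, in the setting of the MA-BC guarantee with `K = |X \ X_common|` and `|X| ≥ 2K`,
if `N ≥ c·C·|X|/((1-γ)²ε)` and every `N_ℓ ≥ c·K/((1-γ)²ε)` (with
`C = max_ℓ ‖ν^{π_ℓ}/ν^{π_data}‖_∞`), then every output policy of MA-BC is an
`ε`-approximate Pareto front policy. -/
theorem mabc_sample_complexity :
    ∃ c : ℝ, 0 < c ∧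
      ∀ (X A : Type) (iX : Fintype X) (iA : Fintype A) (iN : Nonempty X),
        @MABCCorollaryProp X A iX iA iN c := by
  exact ⟨2, by norm_num, fun X A iX iA iN => @aux_main X A iX iA iN⟩
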